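/- Let ρ = N(0, Γ_pr) be the Gaussian measure on ℝⁿ with mean zero and covariance Γ_pr, and ν = N(0, Γ_obs) the Gaussian measure on ℝ^d with mean zero and covariance Γ_obs. For a real n×d matrix A define the Bayes risk Risk(A) = ∫_{ℝⁿ} ∫_{ℝ^d} (A(Gx+e) − x)ᵀ Γ_pos⁻¹ (A(Gx+e) − x) dν(e) dρ(x), where Γ_pos = (H + Γ_pr⁻¹)⁻¹. Let Γ_pos^(r) = Γ_pr − Σ_{i=1}^r (λᵢ/(1+λᵢ)) uᵢ uᵢᵀ and A* = Γ_pos^(r) Pᵣᵀ Gᵀ Γ_obs⁻¹. Then rank(A*) ≤ r, and for every real n×d matrix A with rank(A) ≤ r, Risk(A*) ≤ Risk(A). -/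

import Mathlib

open Matrix MeasureTheory

/-- The Gaussian measure `N(m, Γ)` on `ℝ^k`, defined by its Lebesgue density. -/
noncomputable def gaussianMeasure {k : ℕ} (m : Fin k → ℝ) (Γ : Matrix (Fin k) (Fin k) ℝ) :
    Measure (Fin k → ℝ) :=
  volume.withDensity fun x =>
    ENNReal.ofReal ((Real.sqrt ((2 * Real.pi) ^ k * Γ.det))⁻¹ *
      Real.exp (-(1 / 2) * ((x - m) ⬝ᵥ (Γ⁻¹ *ᵥ (x - m)))))

section

open ProbabilityTheory

theorem pi_gaussianReal_eq_withDensity (k : ℕ) :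
    Measure.pi (fun _ : Fin k => gaussianReal 0 1) =
      (volume : Measure (Fin k → ℝ)).withDensity
        fun y => ENNReal.ofReal (∏ i, gaussianPDFReal 0 1 (y i)) := by
  refine (Measure.pi_eq fun s hs => ?_)
  rw [withDensity_apply _ (.univ_pi hs), volume_pi, Measure.restrict_pi_pi,
    ← ofReal_integral_eq_lintegral_ofReal, integral_fintype_prod_eq_prod,
    ENNReal.ofReal_prod_of_nonneg]
  · exact Finset.prod_congr rfl fun i _ =>
      (gaussianReal_apply_eq_integral 0 one_ne_zero (s i)).symm
  · exact fun i _ => integral_nonneg fun x => gaussianPDFReal_nonneg 0 1 x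
  · exact Integrable.fintype_prod fun i => (integrable_gaussianPDFReal 0 1).restrict
  · exact .of_forall fun x => Finset.prod_nonneg fun i _ => gaussianPDFReal_nonneg 0 1 _

theorem prod_gaussianPDFReal_eq {k : ℕ} (y : Fin k → ℝ) :
    ∏ i, gaussianPDFReal 0 1 (y i) =
      (Real.sqrt ((2 * Real.pi) ^ k))⁻¹ * Real.exp (-(1 / 2) * (y ⬝ᵥ y)) := by
  simp only [gaussianPDFReal, Finset.prod_mul_distrib, ← Real.exp_sum, dotProduct,
    Finset.mul_sum, Finset.prod_const, Finset.card_univ, Fintype.card_fin]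
  congr 1
  · rw [inv_pow, NNReal.coe_one, mul_one, eq_comm, _root_.inv_inj,
      Real.sqrt_eq_iff_mul_self_eq (by positivity) (by positivity), ← mul_pow,
      Real.mul_self_sqrt (by positivity)]
  · congr 1
    refine Finset.sum_congr rfl fun i _ => ?_
    rw [NNReal.coe_one]; ring

/-- `N(0, S Sᵀ)` is the law of `S y` for a standard Gaussian vector `y`. -/
theorem gaussianMeasure_zero_mul_transpose {k : ℕ} (S : Matrix (Fin k) (Fin k) ℝ)
    (hS : S.det ≠ 0) :
    gaussianMeasure 0 (S * Sᵀ) =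
      (Measure.pi fun _ : Fin k => gaussianReal 0 1).map fun y => S *ᵥ y := by
  have hcont : Continuous fun y : Fin k → ℝ => S *ᵥ y := by fun_prop
  have hquad (y : Fin k → ℝ) : (S *ᵥ y) ⬝ᵥ ((S * Sᵀ)⁻¹ *ᵥ (S *ᵥ y)) = y ⬝ᵥ y := by
    have h : Sᵀ * (S * Sᵀ)⁻¹ * S = 1 := by
      rw [Matrix.mul_inv_rev, Matrix.mul_assoc, Matrix.mul_assoc, Matrix.nonsing_inv_mul _ hS.isUnit,
        Matrix.mul_one, Matrix.mul_nonsing_inv _ (by simpa using hS.isUnit)]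
    rw [dotProduct_comm, ← dotProduct_transpose_mulVec, mulVec_mulVec, mulVec_mulVec, h, one_mulVec]
  have hvol : (volume : Measure (Fin k → ℝ)) =
      ENNReal.ofReal |S.det| • Measure.map (fun y => S *ᵥ y) volume := by
    have h := Real.map_matrix_volume_pi_eq_smul_volume_pi hS
    have h' : (fun y => S *ᵥ y) = ⇑(toLin' S) := by ext; simp
    rw [h', h, smul_smul, ← ENNReal.ofReal_mul (abs_nonneg _), ← abs_mul, mul_inv_cancel₀ hS]
    simp
  have hdens : Measurable fun x : Fin k → ℝ =>
      ENNReal.ofReal ((Real.sqrt ((2 * Real.pi) ^ k * (S * Sᵀ).det))⁻¹ *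
      Real.exp (-(1 / 2) * ((x - 0) ⬝ᵥ ((S * Sᵀ)⁻¹ *ᵥ (x - 0))))) := by
    refine ENNReal.measurable_ofReal.comp (Continuous.measurable ?_)
    simp only [sub_zero]
    fun_prop
  ext s hs
  rw [Measure.map_apply hcont.measurable hs, pi_gaussianReal_eq_withDensity, gaussianMeasure,
    withDensity_apply _ hs, withDensity_apply _ (hcont.measurable hs)]
  conv_lhs => rw [hvol]
  rw [Measure.restrict_smul, lintegral_smul_measure,
    setLIntegral_map hs hdens hcont.measurable, smul_eq_mul,
    ← lintegral_const_mul _ (by exact hdens.comp hcont.measurable)]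
  refine lintegral_congr fun y => ?_
  rw [← ENNReal.ofReal_mul (abs_nonneg _), prod_gaussianPDFReal_eq, sub_zero, hquad, det_mul,
    det_transpose, Real.sqrt_mul (by positivity), Real.sqrt_mul_self_eq_abs, mul_inv, ← mul_assoc,
    mul_left_comm, mul_inv_cancel₀ (abs_ne_zero.mpr hS), mul_one]

theorem integral_quadratic_pi_gaussianReal {k : ℕ} (N : Matrix (Fin k) (Fin k) ℝ)
    (l : Fin k → ℝ) (c : ℝ) :
    ∫ y, (y ⬝ᵥ (N *ᵥ y) + l ⬝ᵥ y + c) ∂(Measure.pi fun _ : Fin k => gaussianReal 0 1) =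
      N.trace + c := by
  set π := Measure.pi fun _ : Fin k => gaussianReal 0 1 with hπ
  have hL2 (i : Fin k) : MemLp (fun y : Fin k → ℝ => y i) 2 π :=
    (memLp_id_gaussianReal 2).comp_measurePreserving (measurePreserving_eval _ i)
  have hInt (i : Fin k) : Integrable (fun y : Fin k → ℝ => y i) π :=
    (hL2 i).integrable (by norm_num)
  have hInt2 (i j : Fin k) : Integrable (fun y : Fin k → ℝ => y i * y j) π :=
    (hL2 i).integrable_mul (hL2 j)
  have hmean (i : Fin k) : ∫ y, y i ∂π = 0 := by
    rw [hπ, integral_comp_eval (μ := fun _ : Fin k => gaussianReal 0 1)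
      (f := fun x : ℝ => x) (by fun_prop)]
    exact integral_id_gaussianReal
  have hcov (i j : Fin k) : ∫ y, y i * y j ∂π = if i = j then 1 else 0 := by
    split_ifs with h
    · subst h
      rw [hπ, integral_comp_eval (μ := fun _ : Fin k => gaussianReal 0 1)
        (f := fun x : ℝ => x * x) (by fun_prop)]
      have := variance_eq_integral (μ := gaussianReal 0 1) (X := fun x : ℝ => x) (by fun_prop)
      rw [variance_fun_id_gaussianReal, integral_id_gaussianReal] at this
      simpa [pow_two] using this.symm
    · have hind : iIndepFun (fun (i : Fin k) (y : Fin k → ℝ) => y i) π :=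
        iIndepFun_pi (X := fun _ x => x) fun _ => by fun_prop
      have := (hind.indepFun h).integral_mul_eq_mul_integral
        (hInt i).aestronglyMeasurable (hInt j).aestronglyMeasurable
      simpa [hmean] using this
  have hexp (y : Fin k → ℝ) : y ⬝ᵥ (N *ᵥ y) + l ⬝ᵥ y + c =
      ∑ i, ∑ j, N i j * (y i * y j) + ∑ i, l i * y i + c := by
    simp only [dotProduct, mulVec, Finset.mul_sum]
    congr 2
    exact Finset.sum_congr rfl fun i _ => Finset.sum_congr rfl fun j _ => by ring
  have hI1 : Integrable (fun y : Fin k → ℝ => ∑ i, ∑ j, N i j * (y i * y j)) π :=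
    integrable_finsetSum _ fun i _ => integrable_finsetSum _ fun j _ => (hInt2 i j).const_mul _
  have hI2 : Integrable (fun y : Fin k → ℝ => ∑ i, l i * y i) π :=
    integrable_finsetSum _ fun i _ => (hInt i).const_mul _
  have hI12 : Integrable (fun y : Fin k → ℝ =>
      ∑ i, ∑ j, N i j * (y i * y j) + ∑ i, l i * y i) π := hI1.add hI2
  simp_rw [hexp]
  rw [integral_add hI12 (integrable_const c), integral_add hI1 hI2,
    integral_finsetSum _ fun i _ => (hInt i).const_mul (l i),
    integral_finsetSum _ fun i _ => integrable_finsetSum _ fun j _ =>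
      (hInt2 i j).const_mul (N i j)]
  simp_rw [fun i => integral_finsetSum Finset.univ fun j _ => (hInt2 i j).const_mul (N i j),
    integral_const_mul, hmean, hcov]
  simp [trace]

open scoped MatrixOrder Matrix.Norms.L2Operator in
theorem integral_quadratic_gaussianMeasure {k : ℕ} {Γ : Matrix (Fin k) (Fin k) ℝ} (hΓ : Γ.PosDef)
    (N : Matrix (Fin k) (Fin k) ℝ) (l : Fin k → ℝ) (c : ℝ) :
    ∫ y, (y ⬝ᵥ (N *ᵥ y) + l ⬝ᵥ y + c) ∂(gaussianMeasure 0 Γ) = (N * Γ).trace + c := by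
  obtain ⟨S, hS, rfl⟩ : ∃ S : Matrix (Fin k) (Fin k) ℝ, S.det ≠ 0 ∧ Γ = S * Sᵀ := by
    obtain ⟨B, rfl⟩ := CStarAlgebra.nonneg_iff_eq_star_mul_self.mp hΓ.posSemidef.nonneg
    refine ⟨Bᵀ, fun h => hΓ.det_pos.ne' ?_, by simp [star_eq_conjTranspose]⟩
    rw [det_mul, ← det_transpose B, h, mul_zero]
  rw [gaussianMeasure_zero_mul_transpose S hS,
    integral_map (by fun_prop) (by fun_prop)]
  have h := integral_quadratic_pi_gaussianReal (Sᵀ * N * S) (Sᵀ *ᵥ l) c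
  rw [Matrix.mul_assoc, trace_mul_comm, Matrix.mul_assoc] at h
  rw [← h]
  refine integral_congr_ae (.of_forall fun y => ?_)
  simp only [← mulVec_mulVec, dotProduct_transpose_mulVec]
  rw [dotProduct_comm (N *ᵥ _), mulVec_transpose, ← dotProduct_mulVec]

end

theorem exists_orthogonal_projection_mul_eq_self {m n : Type*} [Fintype m] [DecidableEq m]
    [Fintype n] (B : Matrix m n ℝ) :
    ∃ Q : Matrix m m ℝ, Qᵀ = Q ∧ Q * Q = Q ∧ Q * B = B ∧ Q.trace = B.rank := by
  classical
  let K : Submodule ℝ (EuclideanSpace ℝ m) := LinearMap.range (toEuclideanLin B)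
  let p : EuclideanSpace ℝ m →ₗ[ℝ] EuclideanSpace ℝ m := K.starProjection
  have hidem : p ∘ₗ p = p :=
    congrArg ContinuousLinearMap.toLinearMap (Submodule.isIdempotentElem_starProjection K)
  have hsymm : p.IsSymmetric := K.starProjection_isSymmetric
  refine ⟨toEuclideanLin.symm p, ?_, ?_, ?_, ?_⟩
  · rw [← conjTranspose_eq_transpose_of_trivial]
    exact isSymmetric_toEuclideanLin_iff.mp (by simpa using hsymm)
  · apply toEuclideanLin.injective
    rw [toLpLin_mul_same, LinearEquiv.apply_symm_apply, hidem]
  · apply toEuclideanLin.injective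
    rw [toLpLin_mul_same, LinearEquiv.apply_symm_apply]
    refine LinearMap.ext fun x => ?_
    exact Submodule.starProjection_eq_self_iff.mpr (LinearMap.mem_range_self _ x)
  · have hproj : LinearMap.IsProj K p :=
      ⟨fun x => K.starProjection_apply_mem x, fun x hx => Submodule.starProjection_eq_self_iff.mpr hx⟩
    have h := hproj.trace
    rw [LinearMap.trace_eq_matrix_trace ℝ (PiLp.basisFun 2 ℝ m)] at h
    rw [rank_eq_finrank_range_toLin B (PiLp.basisFun 2 ℝ m) (PiLp.basisFun 2 ℝ n)]
    exact h

/-- Diagonal entries of a symmetric idempotent matrix lie in `[0, 1]`. -/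
theorem diag_mem_Icc_of_idempotent {m : Type*} [Fintype m] {Q : Matrix m m ℝ} (hT : Qᵀ = Q)
    (hQ : Q * Q = Q) (i : m) : Q i i ∈ Set.Icc (0 : ℝ) 1 := by
  classical
  have h : Q i i = ∑ j, Q i j ^ 2 := by
    conv_lhs => rw [← hQ, mul_apply]
    refine Finset.sum_congr rfl fun j _ => ?_
    rw [pow_two, ← congrFun₂ hT j i, transpose_apply]
  have h0 : 0 ≤ Q i i := h ▸ Finset.sum_nonneg fun j _ => sq_nonneg _
  have h1 : Q i i ^ 2 ≤ Q i i := by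
    conv_rhs => rw [h]
    exact Finset.single_le_sum (f := fun j => Q i j ^ 2) (fun j _ => sq_nonneg _)
      (Finset.mem_univ i)
  exact ⟨h0, by nlinarith⟩

/-- For nonincreasing nonnegative `lam` and weights in `[0, 1]` of total at most `r`, the weighted
sum is at most the sum of the first `r` terms. -/
theorem sum_mul_le_sum_first {n r : ℕ} (hrn : r ≤ n) {lam q : Fin n → ℝ} (h0 : ∀ i, 0 ≤ lam i)
    (hdec : ∀ i j : Fin n, i ≤ j → lam j ≤ lam i) (hq : ∀ i, q i ∈ Set.Icc (0 : ℝ) 1)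
    (hsum : ∑ i, q i ≤ r) :
    ∑ i, lam i * q i ≤ ∑ i : Fin n, if (i : ℕ) < r then lam i else 0 := by
  obtain ⟨c, hc0, hlt, hge⟩ : ∃ c : ℝ, 0 ≤ c ∧ (∀ i : Fin n, (i : ℕ) < r → c ≤ lam i) ∧
      ∀ i : Fin n, r ≤ (i : ℕ) → lam i ≤ c := by
    rcases hrn.lt_or_eq with h | h
    · exact ⟨lam ⟨r, h⟩, h0 _, fun i hi => hdec _ _ (Fin.le_def.mpr hi.le),
        fun i hi => hdec _ _ (Fin.le_def.mpr hi)⟩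
    · exact ⟨0, le_rfl, fun i _ => h0 i, fun i hi => absurd i.isLt (by omega)⟩
  have hcard : ∑ i : Fin n, (if (i : ℕ) < r then (1 : ℝ) else 0) = r := by
    rw [Fin.sum_univ_eq_sum_range (fun i => if i < r then (1 : ℝ) else 0), ← Finset.sum_filter]
    have : (Finset.range n).filter (· < r) = Finset.range r := by ext; simp; omega
    simp [this]
  have key : ∀ i : Fin n, (lam i - c) * q i ≤ if (i : ℕ) < r then lam i - c else 0 := fun i => by
    obtain ⟨hq0, hq1⟩ := hq i
    split_ifs with h
    · nlinarith [hlt i h]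
    · nlinarith [hge i (not_lt.mp h)]
  have := Finset.sum_le_sum fun i (_ : i ∈ Finset.univ) => key i
  have e : ∑ i : Fin n, (if (i : ℕ) < r then lam i - c else 0) =
      (∑ i : Fin n, if (i : ℕ) < r then lam i else 0) - c * r := by
    rw [← hcard, Finset.mul_sum, ← Finset.sum_sub_distrib]
    exact Finset.sum_congr rfl fun i _ => by split_ifs <;> simp
  rw [e] at this
  simp only [sub_mul, Finset.sum_sub_distrib, ← Finset.mul_sum] at this
  nlinarith

/-- Best approximation of rank `r` in the weighted Frobenius norm `X ↦ tr (X Σ Xᵀ)`, for a matrix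
`F` with `F Σ Fᵀ` diagonal: no matrix of rank at most `r` does better than truncating the rows
of `F`. -/
theorem trace_truncation_le_of_rank_le {n r : ℕ} {m : Type*} [Fintype m] (hrn : r ≤ n)
    {lam : Fin n → ℝ} (h0 : ∀ i, 0 ≤ lam i) (hdec : ∀ i j : Fin n, i ≤ j → lam j ≤ lam i)
    {C : Matrix m m ℝ} (hC : C.PosSemidef) {F : Matrix (Fin n) m ℝ}
    (hF : F * C * Fᵀ = diagonal lam) {B : Matrix (Fin n) m ℝ} (hB : B.rank ≤ r) :
    let E := diagonal (fun i : Fin n => if (i : ℕ) < r then (1 : ℝ) else 0) * F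
    ((E - F) * C * (E - F)ᵀ).trace ≤ ((B - F) * C * (B - F)ᵀ).trace := by
  intro E
  obtain ⟨Q, hT, hQ, hQB, htr⟩ := exists_orthogonal_projection_mul_eq_self B
  have hleft : ((E - F) * C * (E - F)ᵀ).trace =
      ∑ i, lam i - ∑ i : Fin n, if (i : ℕ) < r then lam i else 0 := by
    have : E - F = diagonal (fun i : Fin n => if (i : ℕ) < r then (0 : ℝ) else -1) * F := by
      ext i j
      by_cases h : (i : ℕ) < r <;> simp [E, diagonal_mul, h]
    rw [this, transpose_mul, diagonal_transpose]
    have : ∀ D : Matrix (Fin n) (Fin n) ℝ, D * F * C * (Fᵀ * D) = D * (F * C * Fᵀ) * D :=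
      fun D => by simp only [Matrix.mul_assoc]
    rw [this, hF, diagonal_mul_diagonal, diagonal_mul_diagonal, trace_diagonal,
      ← Finset.sum_sub_distrib]
    exact Finset.sum_congr rfl fun i _ => by split_ifs <;> simp
  set N := (B - F) * C * (B - F)ᵀ with hN
  have hNpsd : N.PosSemidef := by
    simpa only [conjTranspose_eq_transpose_of_trivial] using hC.mul_mul_conjTranspose_same (B - F)
  have h1 : 0 ≤ (Q * N).trace := by
    have h := (hNpsd.mul_mul_conjTranspose_same Q).trace_nonneg
    rwa [conjTranspose_eq_transpose_of_trivial, hT, trace_mul_comm, ← Matrix.mul_assoc, hQ] at h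
  have h2 : ((1 - Q) * N).trace = ∑ i, lam i - ∑ i, lam i * Q i i := by
    have hR : (1 - Q) * (B - F) = -((1 - Q) * F) := by
      rw [Matrix.mul_sub, Matrix.sub_mul 1 Q B, hQB]; simp
    have hRT : (1 - Q)ᵀ = 1 - Q := by simp [hT]
    have hRR : (1 - Q) * (1 - Q) = 1 - Q := by
      rw [Matrix.mul_sub, Matrix.sub_mul, Matrix.sub_mul, hQ]; simp
    calc ((1 - Q) * N).trace = ((1 - Q) * (B - F) * C * ((1 - Q) * (B - F))ᵀ).trace := by
          conv_lhs => rw [← hRR]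
          rw [Matrix.mul_assoc, trace_mul_comm, transpose_mul, hRT]
          simp only [hN, Matrix.mul_assoc]
      _ = ((1 - Q) * F * C * ((1 - Q) * F)ᵀ).trace := by
          rw [hR]; simp
      _ = ((1 - Q) * (F * C * Fᵀ)).trace := by
          conv_rhs => rw [← hRR]
          rw [Matrix.mul_assoc (1 - Q) (1 - Q), trace_mul_comm (1 - Q) ((1 - Q) * _),
            transpose_mul, hRT]
          simp only [Matrix.mul_assoc]
      _ = _ := by
          rw [hF, Matrix.sub_mul, trace_sub, Matrix.one_mul, trace_diagonal]
          congr 1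
          simp [trace, mul_comm]
  have h3 : N.trace = ((1 - Q) * N).trace + (Q * N).trace := by
    rw [← trace_add, ← Matrix.add_mul]; simp
  have h4 := sum_mul_le_sum_first hrn h0 hdec (fun i => diag_mem_Icc_of_idempotent hT hQ i)
    (show ∑ i, Q i i ≤ r by
      have : ∑ i, Q i i = Q.trace := rfl
      rw [this, htr]; exact_mod_cast hB)
  rw [hleft]
  linarith

/-- The Bayes risk, in closed form, when the weight is `R Rᵀ` and `A₀` is the unconstrained
minimizer. -/
theorem integral_integral_quadratic_gaussianMeasure {n d : ℕ} {Γpr R : Matrix (Fin n) (Fin n) ℝ}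
    {Γobs : Matrix (Fin d) (Fin d) ℝ} (hΓpr : Γpr.PosDef) (hΓobs : Γobs.PosDef)
    {G : Matrix (Fin d) (Fin n) ℝ} {A₀ : Matrix (Fin n) (Fin d) ℝ}
    (hA₀ : A₀ * (G * Γpr * Gᵀ + Γobs) = Γpr * Gᵀ) (A : Matrix (Fin n) (Fin d) ℝ) :
    ∫ x, ∫ e, ((A *ᵥ (G *ᵥ x + e) - x) ⬝ᵥ ((R * Rᵀ) *ᵥ (A *ᵥ (G *ᵥ x + e) - x)))
        ∂(gaussianMeasure 0 Γobs) ∂(gaussianMeasure 0 Γpr) =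
      ((Rᵀ * A - Rᵀ * A₀) * (G * Γpr * Gᵀ + Γobs) * (Rᵀ * A - Rᵀ * A₀)ᵀ).trace +
        ((Rᵀ * Γpr * R).trace - (Rᵀ * A₀ * (G * Γpr * Gᵀ + Γobs) * (Rᵀ * A₀)ᵀ).trace) := by
  have hq1 (z : Fin n → ℝ) : z ⬝ᵥ ((R * Rᵀ) *ᵥ z) = (Rᵀ *ᵥ z) ⬝ᵥ (Rᵀ *ᵥ z) := by
    rw [← mulVec_mulVec, dotProduct_mulVec, ← mulVec_transpose]
  have hq2 {p : ℕ} (M : Matrix (Fin n) (Fin p) ℝ) (y : Fin p → ℝ) :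
      y ⬝ᵥ ((Mᵀ * M) *ᵥ y) = (M *ᵥ y) ⬝ᵥ (M *ᵥ y) := by
    rw [← mulVec_mulVec, dotProduct_transpose_mulVec]
  set K := Rᵀ * A with hK
  set J := Rᵀ * (A * G - 1) with hJ
  have hsq (x : Fin n → ℝ) (e : Fin d → ℝ) :
      (A *ᵥ (G *ᵥ x + e) - x) ⬝ᵥ ((R * Rᵀ) *ᵥ (A *ᵥ (G *ᵥ x + e) - x)) =
        e ⬝ᵥ ((Kᵀ * K) *ᵥ e) + (2 • (Kᵀ *ᵥ (J *ᵥ x))) ⬝ᵥ e + x ⬝ᵥ ((Jᵀ * J) *ᵥ x) := by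
    have h1 : Rᵀ *ᵥ (A *ᵥ (G *ᵥ x + e) - x) = J *ᵥ x + K *ᵥ e := by
      simp only [hJ, hK, ← mulVec_mulVec, sub_mulVec, mulVec_add, mulVec_sub, one_mulVec]
      abel
    rw [hq1, h1, hq2 K, hq2 J, smul_dotProduct, dotProduct_comm (Kᵀ *ᵥ _),
      dotProduct_transpose_mulVec]
    simp only [dotProduct_add, add_dotProduct, nsmul_eq_mul, dotProduct_comm (K *ᵥ e) (J *ᵥ x)]
    push_cast
    ring
  have hin (x : Fin n → ℝ) : ∫ e, ((A *ᵥ (G *ᵥ x + e) - x) ⬝ᵥ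
      ((R * Rᵀ) *ᵥ (A *ᵥ (G *ᵥ x + e) - x))) ∂(gaussianMeasure 0 Γobs) =
        x ⬝ᵥ ((Jᵀ * J) *ᵥ x) + 0 ⬝ᵥ x + (Kᵀ * K * Γobs).trace := by
    simp_rw [hsq]
    rw [integral_quadratic_gaussianMeasure hΓobs, zero_dotProduct]
    ring
  simp_rw [hin]
  rw [integral_quadratic_gaussianMeasure hΓpr]
  have hprT : Γprᵀ = Γpr := by simpa using hΓpr.isHermitian.eq
  have hA₀' : (G * Γpr * Gᵀ + Γobs) * A₀ᵀ = G * Γpr := by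
    have hobsT : Γobsᵀ = Γobs := by simpa using hΓobs.isHermitian.eq
    simpa [Matrix.mul_assoc, hprT, hobsT] using congrArg transpose hA₀
  have e1 : (Jᵀ * J * Γpr).trace = (K * (G * Γpr * Gᵀ) * Kᵀ).trace -
      (Rᵀ * Γpr * Gᵀ * Kᵀ).trace - (K * G * Γpr * R).trace + (Rᵀ * Γpr * R).trace := by
    have hJ' : J = K * G - Rᵀ := by rw [hJ, hK]; simp [Matrix.mul_sub, Matrix.mul_assoc]
    rw [Matrix.mul_assoc, trace_mul_comm, hJ']
    simp only [transpose_sub, transpose_mul, transpose_transpose, Matrix.mul_sub, Matrix.sub_mul,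
      trace_sub, Matrix.mul_assoc]
    ring
  have e2 : (Kᵀ * K * Γobs).trace = (K * Γobs * Kᵀ).trace := by
    rw [Matrix.mul_assoc, trace_mul_comm]
  have e3 : Rᵀ * A₀ * (G * Γpr * Gᵀ + Γobs) = Rᵀ * Γpr * Gᵀ := by
    rw [Matrix.mul_assoc, hA₀, Matrix.mul_assoc]
  have e4 : K * (G * Γpr * Gᵀ + Γobs) * (Rᵀ * A₀)ᵀ = K * G * Γpr * R := by
    rw [transpose_mul, transpose_transpose, Matrix.mul_assoc, ← Matrix.mul_assoc _ A₀ᵀ, hA₀']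
    simp only [Matrix.mul_assoc]
  rw [e1, e2, transpose_sub, Matrix.mul_sub, Matrix.sub_mul, Matrix.sub_mul, Matrix.sub_mul, e4, e3,
    Matrix.mul_add, Matrix.add_mul]
  simp only [trace_sub, trace_add]
  ring

theorem Fin.sum_castLE {M : Type*} [AddCommMonoid M] {r n : ℕ} (h : r ≤ n) (f : Fin n → M) :
    ∑ j : Fin r, f (Fin.castLE h j) = ∑ i : Fin n, if (i : ℕ) < r then f i else 0 := by
  obtain ⟨k, rfl⟩ := Nat.exists_eq_add_of_le h
  rw [Fin.sum_univ_add]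
  simp
  rfl

/-- the matrix `A* = Γ_pos^(r) Pᵣᵀ Gᵀ Γ_obs⁻¹` has rank at most `r`
and minimizes the Bayes risk
`Risk(A) = ∫∫ (A(Gx+e) − x)ᵀ Γ_pos⁻¹ (A(Gx+e) − x) dν(e) dρ(x)`
over all `n×d` matrices `A` of rank at most `r`, where `ρ = N(0, Γ_pr)` and
`ν = N(0, Γ_obs)`. -/
theorem stmt_1 {n d : ℕ} (hn : 1 ≤ n) (hd : 1 ≤ d)
    (Γpr L : Matrix (Fin n) (Fin n) ℝ)
    (hΓpr : Γpr.PosDef) (hL : IsUnit L.det) (hLL : Γpr = L * Lᵀ)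
    (Γobs : Matrix (Fin d) (Fin d) ℝ) (hΓobs : Γobs.PosDef)
    (G : Matrix (Fin d) (Fin n) ℝ)
    (H : Matrix (Fin n) (Fin n) ℝ) (hH : H = Gᵀ * Γobs⁻¹ * G)
    (v : Fin n → Fin n → ℝ) (lam : Fin n → ℝ)
    (hON : ∀ i j, v i ⬝ᵥ v j = if i = j then (1 : ℝ) else 0)
    (heig : ∀ i, (Lᵀ * H * L) *ᵥ v i = lam i • v i)
    (hdec : ∀ i j : Fin n, i ≤ j → lam j ≤ lam i)
    (u w : Fin n → Fin n → ℝ)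
    (hu : ∀ i, u i = L *ᵥ v i) (hw : ∀ i, w i = (Lᵀ)⁻¹ *ᵥ v i)
    (r : ℕ) (hr1 : 1 ≤ r) (hrn : r ≤ n)
    (U W : Matrix (Fin n) (Fin r) ℝ)
    (hU : ∀ i j, U i j = u (Fin.castLE hrn j) i)
    (hW : ∀ i j, W i j = w (Fin.castLE hrn j) i)
    (P : Matrix (Fin n) (Fin n) ℝ) (hP : P = U * Wᵀ)
    (Γpos : Matrix (Fin n) (Fin n) ℝ) (hΓpos : Γpos = (H + Γpr⁻¹)⁻¹)
    (Γposr : Matrix (Fin n) (Fin n) ℝ)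
    (hΓposr : Γposr = Γpr - ∑ i ∈ Finset.univ.filter (fun i : Fin n => (i : ℕ) < r),
        (lam i / (1 + lam i)) • vecMulVec (u i) (u i))
    (Astar : Matrix (Fin n) (Fin d) ℝ) (hAstar : Astar = Γposr * Pᵀ * Gᵀ * Γobs⁻¹)
    (Risk : Matrix (Fin n) (Fin d) ℝ → ℝ)
    (hRisk : ∀ A : Matrix (Fin n) (Fin d) ℝ,
      Risk A = ∫ x, ∫ e,
          ((A *ᵥ (G *ᵥ x + e) - x) ⬝ᵥ (Γpos⁻¹ *ᵥ (A *ᵥ (G *ᵥ x + e) - x)))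
          ∂(gaussianMeasure 0 Γobs) ∂(gaussianMeasure 0 Γpr)) :
    Astar.rank ≤ r ∧
      ∀ A : Matrix (Fin n) (Fin d) ℝ, A.rank ≤ r → Risk Astar ≤ Risk A := by
  refine ⟨?_, fun A hA => ?_⟩
  · have hAstar' : Astar = Γposr * W * (Uᵀ * Gᵀ * Γobs⁻¹) := by
      rw [hAstar, hP, transpose_mul, transpose_transpose]
      simp only [Matrix.mul_assoc]
    rw [hAstar']
    exact (rank_mul_le_left _ _).trans ((rank_mul_le_right _ _).trans (rank_le_width W))
  set V : Matrix (Fin n) (Fin n) ℝ := of fun i j => v j i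
  have hVV : Vᵀ * V = 1 := by
    ext i j
    simpa [mul_apply, one_apply, dotProduct, V] using hON i j
  have hVV' : V * Vᵀ = 1 := mul_eq_one_comm.mp hVV
  set T := L * V with hT
  have hHpsd : H.PosSemidef := by
    rw [hH]
    simpa [conjTranspose_eq_transpose_of_trivial] using
      hΓobs.inv.posSemidef.conjTranspose_mul_mul_same G
  have hdiag : Tᵀ * H * T = diagonal lam := by
    have h : (Lᵀ * H * L) * V = V * diagonal lam := by
      ext i j
      have := congrFun (heig j) i
      rw [mul_diagonal, mul_comm]
      exact this
    calc Tᵀ * H * T = Vᵀ * ((Lᵀ * H * L) * V) := by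
          rw [hT, transpose_mul]; simp only [Matrix.mul_assoc]
      _ = diagonal lam := by rw [h, ← Matrix.mul_assoc, hVV, Matrix.one_mul]
  have hlam (i : Fin n) : 0 ≤ lam i := by
    have h : (diagonal lam).PosSemidef := by
      rw [← hdiag]
      simpa [conjTranspose_eq_transpose_of_trivial] using hHpsd.conjTranspose_mul_mul_same T
    exact posSemidef_diagonal_iff.mp h i
  have hpos (i : Fin n) : 0 < 1 + lam i := by linarith [hlam i]
  have hTT : T * Tᵀ = Γpr := by
    rw [hT, transpose_mul, Matrix.mul_assoc, ← Matrix.mul_assoc V, hVV', Matrix.one_mul, hLL]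
  set S := Vᵀ * L⁻¹ with hS
  have hST : S * T = 1 := by
    rw [hS, hT, Matrix.mul_assoc, nonsing_inv_mul_cancel_left _ _ hL, hVV]
  have hTS : T * S = 1 := mul_eq_one_comm.mp hST
  have hST' : Tᵀ * Sᵀ = 1 := by rw [← transpose_mul, hST, transpose_one]
  have hTS' : Sᵀ * Tᵀ = 1 := by rw [← transpose_mul, hTS, transpose_one]
  set D := diagonal fun i => Real.sqrt (1 + lam i) with hD
  set Di := diagonal fun i => (1 + lam i)⁻¹ with hDi
  have hDD : D * D = 1 + diagonal lam := by
    rw [hD, diagonal_mul_diagonal, ← diagonal_one, diagonal_add]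
    congr 1
    ext i
    exact Real.mul_self_sqrt (hpos i).le
  have hDiD : Di * (1 + diagonal lam) = 1 := by
    rw [hDi, ← diagonal_one, diagonal_add, diagonal_mul_diagonal]
    congr 1
    ext i
    exact inv_mul_cancel₀ (hpos i).ne'
  set R := Sᵀ * D with hR
  have hRT : Rᵀ = D * S := by rw [hR, transpose_mul, transpose_transpose, hD, diagonal_transpose]
  have hH' : H = Sᵀ * diagonal lam * S := by
    rw [← hdiag]
    calc H = (Sᵀ * Tᵀ) * H * (T * S) := by rw [hTS, hTS', Matrix.one_mul, Matrix.mul_one]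
      _ = _ := by simp only [Matrix.mul_assoc]
  have hprinv : Γpr⁻¹ = Sᵀ * S := by
    refine inv_eq_right_inv ?_
    rw [← hTT, Matrix.mul_assoc, ← Matrix.mul_assoc Tᵀ, hST', Matrix.one_mul, hTS]
  have hM : Γpos⁻¹ = R * Rᵀ := by
    have hpd : (H + Γpr⁻¹).PosDef := hΓpr.inv.posSemidef_add hHpsd
    rw [hΓpos, nonsing_inv_nonsing_inv _ hpd.det_pos.ne'.isUnit, hprinv, hH', hR, hRT,
      Matrix.mul_assoc Sᵀ D, ← Matrix.mul_assoc D D, hDD]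
    simp only [Matrix.mul_add, Matrix.add_mul, Matrix.one_mul, Matrix.mul_assoc]
    exact add_comm _ _
  set C := G * Γpr * Gᵀ + Γobs with hC
  have hCpsd : C.PosSemidef := by
    have h := (hΓpr.posSemidef.mul_mul_conjTranspose_same G).add hΓobs.posSemidef
    rwa [conjTranspose_eq_transpose_of_trivial] at h
  have hobs : Γobs⁻¹ * Γobs = 1 := nonsing_inv_mul _ hΓobs.det_pos.ne'.isUnit
  have hobsT : Γobs⁻¹ᵀ = Γobs⁻¹ := by simpa using hΓobs.inv.isHermitian.eq
  set A₀ := T * Di * Tᵀ * Gᵀ * Γobs⁻¹ with hA₀def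
  have hA₀ : A₀ * C = Γpr * Gᵀ := by
    calc A₀ * C = T * Di * (Tᵀ * (Gᵀ * Γobs⁻¹ * G) * (T * Tᵀ)) * Gᵀ +
          T * Di * Tᵀ * Gᵀ * (Γobs⁻¹ * Γobs) := by
          rw [hC, hA₀def, ← hTT, Matrix.mul_add]
          simp only [Matrix.mul_assoc]
      _ = T * (Di * (1 + Tᵀ * H * T)) * Tᵀ * Gᵀ := by
          rw [← hH, hobs]
          simp only [Matrix.mul_assoc, Matrix.mul_add, Matrix.add_mul, Matrix.mul_one]
          exact add_comm _ _
      _ = Γpr * Gᵀ := by rw [hdiag, hDiD, Matrix.mul_one, hTT]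
  have hF0 : Rᵀ * A₀ = D * Di * Tᵀ * Gᵀ * Γobs⁻¹ := by
    rw [hRT, hA₀def]
    simp only [Matrix.mul_assoc]
    rw [← Matrix.mul_assoc S, hST, Matrix.one_mul]
  have hF : Rᵀ * A₀ * C * (Rᵀ * A₀)ᵀ = diagonal lam := by
    have hDT : Dᵀ = D := by rw [hD, diagonal_transpose]
    have hDiT : Diᵀ = Di := by rw [hDi, diagonal_transpose]
    calc Rᵀ * A₀ * C * (Rᵀ * A₀)ᵀ
        = D * S * (T * Tᵀ * Gᵀ) * (D * Di * Tᵀ * Gᵀ * Γobs⁻¹)ᵀ := by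
          rw [← hF0, Matrix.mul_assoc Rᵀ, hA₀, hRT, hTT]
      _ = D * (S * T) * (Tᵀ * (Gᵀ * Γobs⁻¹ * G) * T) * Di * D := by
          simp only [transpose_mul, transpose_transpose, hDT, hDiT, hobsT, Matrix.mul_assoc]
      _ = D * diagonal lam * Di * D := by rw [hST, ← hH, hdiag, Matrix.mul_one]
      _ = diagonal lam := by
          rw [hD, hDi, diagonal_mul_diagonal, diagonal_mul_diagonal, diagonal_mul_diagonal]
          congr 1
          ext i
          have h := Real.mul_self_sqrt (hpos i).le
          have h' := (hpos i).ne'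
          calc _ = (√(1 + lam i) * √(1 + lam i)) * lam i * (1 + lam i)⁻¹ := by ring
            _ = lam i := by rw [h]; field_simp
  set E := diagonal fun i : Fin n => if (i : ℕ) < r then (1 : ℝ) else 0 with hE
  have hTa (i a : Fin n) : u i a = T a i := by
    rw [hu]
    simp [T, V, mul_apply, mulVec, dotProduct]
  have hPE : P = T * E * S := by
    ext a b
    have hSb (i : Fin n) : w i b = S i b := by
      rw [hw, ← transpose_nonsing_inv]
      simp [S, V, mul_apply, mulVec, dotProduct, mul_comm]
    rw [hP, mul_apply]
    simp only [transpose_apply, hU, hW]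
    rw [Fin.sum_castLE hrn fun i => u i a * w i b, mul_apply]
    refine Finset.sum_congr rfl fun i _ => ?_
    rw [hE, mul_diagonal, hSb, hTa]
    split_ifs <;> simp
  have hposrE : Γposr = T * (1 - E * diagonal fun i => lam i / (1 + lam i)) * Tᵀ := by
    rw [hΓposr, Matrix.mul_sub, Matrix.sub_mul, Matrix.mul_one, hTT]
    congr 1
    ext a b
    rw [Matrix.sum_apply, Finset.sum_filter, hE, diagonal_mul_diagonal, mul_apply]
    refine Finset.sum_congr rfl fun i _ => ?_
    rw [mul_diagonal, transpose_apply, Matrix.smul_apply, vecMulVec_apply, hTa, hTa, smul_eq_mul]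
    split_ifs <;> ring
  have hstar : Rᵀ * Astar = E * (Rᵀ * A₀) := by
    have hED : D * (1 - E * diagonal fun i => lam i / (1 + lam i)) * E = E * (D * Di) := by
      rw [hD, hDi, hE, diagonal_mul_diagonal, ← diagonal_one, diagonal_sub, diagonal_mul_diagonal,
        diagonal_mul_diagonal, diagonal_mul_diagonal, diagonal_mul_diagonal]
      congr 1
      ext i
      have h' := (hpos i).ne'
      split_ifs
      · field_simp
        ring
      · simp
    have hET : Eᵀ = E := by rw [hE, diagonal_transpose]
    calc Rᵀ * Astar
        = D * (S * T) * (1 - E * diagonal fun i => lam i / (1 + lam i)) * (Tᵀ * Sᵀ) * E * Tᵀ *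
            Gᵀ * Γobs⁻¹ := by
          rw [hAstar, hRT, hposrE, hPE]
          simp only [transpose_mul, hET, Matrix.mul_assoc]
      _ = E * (Rᵀ * A₀) := by
          rw [hST, hST', Matrix.mul_one, Matrix.mul_one, hED, hF0]
          simp only [Matrix.mul_assoc]
  simp_rw [hM, integral_integral_quadratic_gaussianMeasure hΓpr hΓobs hA₀] at hRisk
  rw [hRisk, hRisk, hstar]
  gcongr
  exact trace_truncation_le_of_rank_le hrn hlam hdec hCpsd hF ((rank_mul_le_right _ _).trans hA)
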